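/- (Theorem 1: lower bound on the value of multistage stochastic programming.) Assume f_s ≥ 0 and c_s ≥ 0 componentwise for every stage s, λ_s ∈ [0,1] and α_s ∈ [0,1) for s = 2,…,T, and that every matrix B_s has nonnegative entries. Let (x*, y*, η*, u*) be an optimal solution of the two-stage model, i.e. a two-stage-feasible tuple with F(x*,y*,η*,u*) ≤ F(x,y,η,u) for every two-stage-feasible (x,y,η,u), and let z^MS be the infimum of F over the multistage-feasible tuples (a real number: this set is nonempty and F ≥ 0 on it under the stated assumptions). Then, with (ŷ,û) = (y*,u*), b_n = B_{τ(n)} y*_n, b̄_n = max_{l∈𝒯_{τ(n)}} b_l, and the constructed η^TS, η^MS: F(x*,y*,η*,u*) − z^MS ≥ ∑_{n≠r} p_n (1−λ_{τ(n)}) f_{τ(n)} · ( max_{m∈𝒫(n)} ⌈b̄_m⌉ − max_{m∈𝒫(n)} ⌈b_m⌉ ) + ∑_{n∉ℒ} p_n λ_{τ(n)+1} ( η^TS_n − η^MS_n ). -/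

import Mathlib

open Finset

/-- A scenario tree with `T` stages: a finite nonempty set of nodes with a root,
a parent map fixing the root, a stage map decreasing by one along the parent map,
such that every node reaches the root by iterating the parent map, and every
non-leaf node has a child. -/
structure STree (T : ℕ) : Type 1 where
  Node : Type
  fin : Fintype Node
  deceq : DecidableEq Node
  root : Node
  parent : Node → Node
  stage : Node → ℕ
  hT : 1 ≤ T
  parent_root : parent root = root
  stage_root : stage root = 1
  stage_ge : ∀ n, 1 ≤ stage n
  stage_le : ∀ n, stage n ≤ T
  stage_parent : ∀ n, n ≠ root → stage (parent n) = stage n - 1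
  reaches_root : ∀ n, ∃ k, parent^[k] n = root
  children_ne : ∀ n, stage n ≠ T → ∃ m, m ≠ root ∧ parent m = n

attribute [instance] STree.fin STree.deceq

namespace STree

variable {T : ℕ} (S : STree T)

/-- The path set `𝒫(n) = {aᵏ(n) : k ≥ 0}` of a node. -/
def path (n : S.Node) : Finset S.Node :=
  (Finset.range T).image fun k => S.parent^[k] n

theorem path_nonempty (n : S.Node) : (S.path n).Nonempty :=
  ⟨n, Finset.mem_image.mpr ⟨0, Finset.mem_range.mpr S.hT, rfl⟩⟩

/-- The children `𝒞(n)` of a node. -/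
def children (n : S.Node) : Finset S.Node :=
  Finset.univ.filter fun m => m ≠ S.root ∧ S.parent m = n

theorem children_nonempty {n : S.Node} (h : S.stage n ≠ T) : (S.children n).Nonempty := by
  obtain ⟨m, h1, h2⟩ := S.children_ne n h
  exact ⟨m, Finset.mem_filter.mpr ⟨Finset.mem_univ m, h1, h2⟩⟩

/-- The set `𝒯ₛ` of stage-`s` nodes. -/
def stageNodes (s : ℕ) : Finset S.Node :=
  Finset.univ.filter fun n => S.stage n = s

theorem stageNodes_self_nonempty (n : S.Node) : (S.stageNodes (S.stage n)).Nonempty :=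
  ⟨n, Finset.mem_filter.mpr ⟨Finset.mem_univ n, rfl⟩⟩

end STree

section Constructions

variable {T M J : ℕ}

/-- `b_n = B_{τ(n)} ŷ_n` (componentwise). -/
noncomputable def bvec (S : STree T) (B : ℕ → Matrix (Fin M) (Fin J) ℝ)
    (yh : S.Node → Fin J → ℝ) (n : S.Node) (i : Fin M) : ℝ :=
  (B (S.stage n)).mulVec (yh n) i

/-- Componentwise maximum of `b` over all nodes of the same stage as `n`
(used for `b̄_n = max_{l ∈ 𝒯_{τ(n)}} b_l`). -/
noncomputable def stageMax (S : STree T) (b : S.Node → Fin M → ℝ) (n : S.Node) (i : Fin M) : ℝ :=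
  (S.stageNodes (S.stage n)).sup' (S.stageNodes_self_nonempty n) fun l => b l i

/-- `max_{m ∈ 𝒫(n)} ⌈b_m⌉` (componentwise). -/
noncomputable def pmc (S : STree T) (b : S.Node → Fin M → ℝ) (n : S.Node) (i : Fin M) : ℤ :=
  (S.path n).sup' (S.path_nonempty n) fun m => ⌈b m i⌉

/-- `max_{m ∈ 𝒫(n)} b_m` (componentwise, no rounding). -/
noncomputable def pm (S : STree T) (b : S.Node → Fin M → ℝ) (n : S.Node) (i : Fin M) : ℝ :=
  (S.path n).sup' (S.path_nonempty n) fun m => b m i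

end Constructions

section CapacityModel

variable {T M N J : ℕ}

/-- Multistage feasibility (with the capacity variables `x` taken real, for LP
relaxations; the integer model uses the coercion of an integer `x`). -/
def MFeasR (S : STree T) (f : ℕ → Fin M → ℝ) (c : ℕ → Fin J → ℝ)
    (A : ℕ → Matrix (Fin N) (Fin J) ℝ) (B : ℕ → Matrix (Fin M) (Fin J) ℝ)
    (d : S.Node → Fin N → ℝ)
    (x : S.Node → Fin M → ℝ) (y : S.Node → Fin J → ℝ) (η u : S.Node → ℝ) : Prop :=
  (∀ n i, 0 ≤ x n i) ∧ (∀ n j, 0 ≤ y n j) ∧ (∀ n, n ≠ S.root → 0 ≤ u n) ∧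
  (∀ n, (A (S.stage n)).mulVec (y n) = d n) ∧
  (∀ n i, (B (S.stage n)).mulVec (y n) i ≤ ∑ m ∈ S.path n, x m i) ∧
  ∀ n, n ≠ S.root →
    (∑ i, f (S.stage n) i * ∑ m ∈ S.path n, x m i) + (∑ j, c (S.stage n) j * y n j)
      ≤ u n + η (S.parent n)

/-- The two-stage (non-anticipativity) constraint: capacity decisions agree on
nodes of the same stage. -/
def TSconstr (S : STree T) (x : S.Node → Fin M → ℝ) : Prop :=
  ∀ m n, S.stage m = S.stage n → x m = x n

/-- The risk-averse objective
`F(x,y,η,u) = ∑_n p_n ( f̃_n·∑_{m∈𝒫(n)} x_m + c̃_n·y_n + λ̃_n η_n + α̃_n u_n )`,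
where `f̃, c̃, λ̃, α̃` are the derived ECRM coefficients. -/
noncomputable def FR (S : STree T) (p : S.Node → ℝ) (f : ℕ → Fin M → ℝ) (c : ℕ → Fin J → ℝ)
    (lam alpha : ℕ → ℝ)
    (x : S.Node → Fin M → ℝ) (y : S.Node → Fin J → ℝ) (η u : S.Node → ℝ) : ℝ :=
  ∑ n, p n *
    ((∑ i, (if n = S.root then f 1 i else (1 - lam (S.stage n)) * f (S.stage n) i)
        * ∑ m ∈ S.path n, x m i)
     + (∑ j, (if n = S.root then c 1 j else (1 - lam (S.stage n)) * c (S.stage n) j) * y n j)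
     + (if S.stage n = T then 0 else lam (S.stage n + 1)) * η n
     + (if n = S.root then 0 else lam (S.stage n) / (1 - alpha (S.stage n))) * u n)

/-- Optimal value of the risk-averse multistage model (integer capacities). -/
noncomputable def zMS (S : STree T) (p : S.Node → ℝ) (f : ℕ → Fin M → ℝ) (c : ℕ → Fin J → ℝ)
    (A : ℕ → Matrix (Fin N) (Fin J) ℝ) (B : ℕ → Matrix (Fin M) (Fin J) ℝ)
    (d : S.Node → Fin N → ℝ) (lam alpha : ℕ → ℝ) : ℝ :=
  sInf {v : ℝ | ∃ (x : S.Node → Fin M → ℤ) (y : S.Node → Fin J → ℝ) (η u : S.Node → ℝ),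
    MFeasR S f c A B d (fun n i => (x n i : ℝ)) y η u ∧
    v = FR S p f c lam alpha (fun n i => (x n i : ℝ)) y η u}

/-- Optimal value of the risk-averse two-stage model (integer capacities). -/
noncomputable def zTS (S : STree T) (p : S.Node → ℝ) (f : ℕ → Fin M → ℝ) (c : ℕ → Fin J → ℝ)
    (A : ℕ → Matrix (Fin N) (Fin J) ℝ) (B : ℕ → Matrix (Fin M) (Fin J) ℝ)
    (d : S.Node → Fin N → ℝ) (lam alpha : ℕ → ℝ) : ℝ :=
  sInf {v : ℝ | ∃ (x : S.Node → Fin M → ℤ) (y : S.Node → Fin J → ℝ) (η u : S.Node → ℝ),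
    MFeasR S f c A B d (fun n i => (x n i : ℝ)) y η u ∧
    TSconstr S (fun n i => (x n i : ℝ)) ∧
    v = FR S p f c lam alpha (fun n i => (x n i : ℝ)) y η u}

end CapacityModel

namespace STree

variable {T : ℕ} (S : STree T)

theorem stage_eq_one_iff {n : S.Node} : S.stage n = 1 ↔ n = S.root := by
  refine ⟨fun h => ?_, fun h => h ▸ S.stage_root⟩
  by_contra hn
  have h1 := S.stage_parent n hn
  have h2 := S.stage_ge (S.parent n)
  omega

theorem two_le_stage {n : S.Node} (hn : n ≠ S.root) : 2 ≤ S.stage n := by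
  have h1 := S.stage_ge n
  have h2 := mt S.stage_eq_one_iff.mp hn
  omega

theorem stage_parent_add_one {n : S.Node} (hn : n ≠ S.root) :
    S.stage (S.parent n) + 1 = S.stage n := by
  have h1 := S.stage_parent n hn
  have h2 := S.two_le_stage hn
  omega

theorem induction_on_parent {P : S.Node → Prop} (root : P S.root)
    (step : ∀ n, n ≠ S.root → P (S.parent n) → P n) (n : S.Node) : P n := by
  induction hk : S.stage n using Nat.strong_induction_on generalizing n with
  | _ k ih =>
    by_cases hn : n = S.root
    · exact hn ▸ root
    · have h := S.stage_parent_add_one hn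
      exact step n hn (ih _ (by omega) _ rfl)

theorem parent_iterate_root (k : ℕ) : S.parent^[k] S.root = S.root :=
  Function.iterate_fixed S.parent_root k

theorem parent_iterate_eq_root (n : S.Node) : S.parent^[S.stage n - 1] n = S.root := by
  induction n using S.induction_on_parent with
  | root => exact S.parent_iterate_root _
  | step n hn ih =>
    have h := S.stage_parent_add_one hn
    have h1 := S.stage_ge (S.parent n)
    rw [show S.stage n - 1 = (S.stage (S.parent n) - 1) + 1 by omega,
      Function.iterate_succ_apply, ih]

theorem mem_path {n m : S.Node} : m ∈ S.path n ↔ ∃ k, S.parent^[k] n = m := by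
  simp only [path, Finset.mem_image, Finset.mem_range]
  refine ⟨fun ⟨k, _, h⟩ => ⟨k, h⟩, fun ⟨k, h⟩ => ?_⟩
  have h1 := S.stage_ge n
  have h2 := S.stage_le n
  by_cases hk : k < T
  · exact ⟨k, hk, h⟩
  · refine ⟨S.stage n - 1, by omega, ?_⟩
    rw [← h, show k = (k - (S.stage n - 1)) + (S.stage n - 1) by omega,
      Function.iterate_add_apply, S.parent_iterate_eq_root, S.parent_iterate_root]

theorem self_mem_path (n : S.Node) : n ∈ S.path n := S.mem_path.mpr ⟨0, rfl⟩

theorem path_root : S.path S.root = {S.root} := by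
  ext m
  simp [mem_path, parent_iterate_root, eq_comm]

theorem path_eq_insert (n : S.Node) : S.path n = insert n (S.path (S.parent n)) := by
  ext m
  simp only [Finset.mem_insert, mem_path]
  constructor
  · rintro ⟨_ | k, h⟩
    · exact Or.inl h.symm
    · exact Or.inr ⟨k, h⟩
  · rintro (h | ⟨k, h⟩)
    · exact ⟨0, h.symm⟩
    · exact ⟨k + 1, h⟩

theorem path_subset {m n : S.Node} (h : m ∈ S.path n) : S.path m ⊆ S.path n := by
  obtain ⟨k, rfl⟩ := S.mem_path.mp h
  intro l hl
  obtain ⟨j, rfl⟩ := S.mem_path.mp hl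
  exact S.mem_path.mpr ⟨j + k, Function.iterate_add_apply _ _ _ _⟩

theorem stage_le_of_mem_path {m n : S.Node} (h : m ∈ S.path n) : S.stage m ≤ S.stage n := by
  induction n using S.induction_on_parent with
  | root => simp_all [path_root]
  | step n hn ih =>
    rw [path_eq_insert, Finset.mem_insert] at h
    rcases h with rfl | h
    · exact le_rfl
    · have := ih h
      have := S.stage_parent_add_one hn
      omega

theorem notMem_path_parent {n : S.Node} (hn : n ≠ S.root) : n ∉ S.path (S.parent n) := by
  intro h
  have h1 := S.stage_le_of_mem_path h
  have h2 := S.stage_parent_add_one hn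
  omega

theorem sum_path {R : Type*} [AddCommMonoid R] (x : S.Node → R) {n : S.Node} (hn : n ≠ S.root) :
    ∑ m ∈ S.path n, x m = x n + ∑ m ∈ S.path (S.parent n), x m := by
  rw [path_eq_insert, Finset.sum_insert (S.notMem_path_parent hn)]

/-- Path sums of a stage-dependent function depend only on the stage. -/
theorem sum_path_congr {R : Type*} [AddCommMonoid R] {x : S.Node → R}
    (hx : ∀ m n, S.stage m = S.stage n → x m = x n) {m n : S.Node}
    (h : S.stage m = S.stage n) : ∑ l ∈ S.path m, x l = ∑ l ∈ S.path n, x l := by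
  induction m using S.induction_on_parent generalizing n with
  | root => rw [S.stage_eq_one_iff.mp (h.symm.trans S.stage_root)]
  | step m hm ih =>
    have hn : n ≠ S.root := by
      rintro rfl
      exact hm (S.stage_eq_one_iff.mp (h.trans S.stage_root))
    have h1 := S.stage_parent_add_one hm
    have h2 := S.stage_parent_add_one hn
    rw [S.sum_path x hm, S.sum_path x hn, hx m n h, ih (n := S.parent n) (by omega)]

/-- A sum over non-root nodes, grouped by parent. -/
theorem sum_children (g : S.Node → ℝ) :
    ∑ n, (if S.stage n = T then 0 else ∑ m ∈ S.children n, g m) =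
      ∑ m, if m = S.root then 0 else g m := by
  have h : ∀ n, (if S.stage n = T then 0 else ∑ m ∈ S.children n, g m) =
      ∑ m ∈ S.children n, g m := by
    intro n
    split_ifs with hn
    · refine (Finset.sum_eq_zero fun m hm => ?_).symm
      obtain ⟨hne, rfl⟩ := (Finset.mem_filter.mp hm).2
      have h1 := S.stage_parent_add_one hne
      have h2 := S.stage_le m
      omega
    · rfl
  have h' : (∑ m, if m = S.root then 0 else g m) =
      ∑ m ∈ Finset.univ.filter (fun m => m ≠ S.root), g m := by
    simp [Finset.sum_filter, ite_not]
  rw [h', Finset.sum_congr rfl fun n _ => h n,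
    ← Finset.sum_fiberwise (Finset.univ.filter fun m => m ≠ S.root) S.parent g]
  simp only [children, Finset.filter_filter]

end STree

section Constructions

variable {T M : ℕ} (S : STree T)

theorem pmc_mono (b : S.Node → Fin M → ℝ) {m n : S.Node} (h : m ∈ S.path n) (i : Fin M) :
    pmc S b m i ≤ pmc S b n i :=
  Finset.sup'_mono _ (S.path_subset h) _

theorem ceil_le_pmc (b : S.Node → Fin M → ℝ) (n : S.Node) (i : Fin M) :
    ⌈b n i⌉ ≤ pmc S b n i :=
  Finset.le_sup' (fun m => ⌈b m i⌉) (S.self_mem_path n)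

theorem pmc_root (b : S.Node → Fin M → ℝ) (i : Fin M) :
    pmc S b S.root i = ⌈b S.root i⌉ := by
  simp [pmc, S.path_root]

theorem stageMax_root (b : S.Node → Fin M → ℝ) (i : Fin M) :
    stageMax S b S.root i = b S.root i := by
  have h : S.stageNodes (S.stage S.root) = {S.root} := by
    ext n
    simp [STree.stageNodes, S.stage_root, S.stage_eq_one_iff]
  simp [stageMax, h]

/-- The constructed expansion decisions telescope along paths. -/
theorem sum_path_eq_pmc {b : S.Node → Fin M → ℝ} {x : S.Node → Fin M → ℤ}
    (hr : ∀ i, x S.root i = ⌈b S.root i⌉)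
    (hx : ∀ n, n ≠ S.root → ∀ i, x n i = pmc S b n i - pmc S b (S.parent n) i)
    (n : S.Node) (i : Fin M) : ∑ m ∈ S.path n, (x m i : ℝ) = pmc S b n i := by
  induction n using S.induction_on_parent with
  | root => simp [S.path_root, pmc_root, hr]
  | step n hn ih =>
    rw [S.sum_path (fun m => (x m i : ℝ)) hn, ih, hx n hn]
    push_cast
    ring

theorem nonneg_of_telescoping {b : S.Node → Fin M → ℝ} {x : S.Node → Fin M → ℤ}
    (hb : ∀ i, 0 ≤ b S.root i) (hr : ∀ i, x S.root i = ⌈b S.root i⌉)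
    (hx : ∀ n, n ≠ S.root → ∀ i, x n i = pmc S b n i - pmc S b (S.parent n) i)
    (n : S.Node) (i : Fin M) : 0 ≤ x n i := by
  by_cases hn : n = S.root
  · subst hn
    rw [hr]
    exact Int.ceil_nonneg (hb i)
  · rw [hx n hn, sub_nonneg]
    exact pmc_mono S b (S.mem_path.mpr ⟨1, rfl⟩) i

/-- Stage-dependent capacities covering `b` dominate the two-stage construction. -/
theorem pmc_stageMax_le {b : S.Node → Fin M → ℝ} {x : S.Node → Fin M → ℤ}
    (h0 : ∀ n i, (0 : ℝ) ≤ x n i) (hts : TSconstr S (fun n i => (x n i : ℝ)))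
    (hb : ∀ n i, b n i ≤ ∑ m ∈ S.path n, (x m i : ℝ)) (n : S.Node) (i : Fin M) :
    (pmc S (stageMax S b) n i : ℝ) ≤ ∑ m ∈ S.path n, (x m i : ℝ) := by
  have key : pmc S (stageMax S b) n i ≤ ∑ m ∈ S.path n, x m i := by
    refine Finset.sup'_le _ _ fun m hm => Int.ceil_le.mpr (Finset.sup'_le _ _ fun l hl => ?_)
    push_cast
    calc b l i ≤ ∑ k ∈ S.path l, (x k i : ℝ) := hb l i
      _ = ∑ k ∈ S.path m, (x k i : ℝ) :=
        S.sum_path_congr (fun k k' hk => congrFun (hts k k' hk) i) (Finset.mem_filter.mp hl).2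
      _ ≤ ∑ k ∈ S.path n, (x k i : ℝ) :=
        Finset.sum_le_sum_of_subset_of_nonneg (S.path_subset hm) fun k _ _ => h0 k i
  exact_mod_cast key

end Constructions

section CapacityModel

variable {T M N J : ℕ} (S : STree T)

/-- The objective is nonnegative on multistage-feasible tuples. -/
theorem FR_nonneg {p : S.Node → ℝ} {f : ℕ → Fin M → ℝ} {c : ℕ → Fin J → ℝ}
    {A : ℕ → Matrix (Fin N) (Fin J) ℝ} {B : ℕ → Matrix (Fin M) (Fin J) ℝ}
    {d : S.Node → Fin N → ℝ} {lam alpha : ℕ → ℝ}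
    (hp : ∀ n, 0 ≤ p n)
    (hpc : ∀ n, S.stage n ≠ T → ∑ m ∈ S.children n, p m = p n)
    (hf : ∀ s, 1 ≤ s → s ≤ T → ∀ i, 0 ≤ f s i)
    (hc : ∀ s, 1 ≤ s → s ≤ T → ∀ j, 0 ≤ c s j)
    (hlam : ∀ s, 2 ≤ s → s ≤ T → 0 ≤ lam s ∧ lam s ≤ 1)
    (halpha : ∀ s, 2 ≤ s → s ≤ T → 0 ≤ alpha s ∧ alpha s < 1)
    {x : S.Node → Fin M → ℝ} {y : S.Node → Fin J → ℝ} {η u : S.Node → ℝ}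
    (h : MFeasR S f c A B d x y η u) : 0 ≤ FR S p f c lam alpha x y η u := by
  obtain ⟨hx, hy, hu, -, -, hcost⟩ := h
  have hη : ∑ n, p n * ((if S.stage n = T then 0 else lam (S.stage n + 1)) * η n) =
      ∑ n, if n = S.root then 0 else p n * (lam (S.stage n) * η (S.parent n)) := by
    rw [← S.sum_children]
    refine Finset.sum_congr rfl fun n _ => ?_
    split_ifs with hn
    · simp
    · rw [← hpc n hn, Finset.sum_mul]
      refine Finset.sum_congr rfl fun m hm => ?_
      obtain ⟨hne, rfl⟩ := (Finset.mem_filter.mp hm).2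
      rw [S.stage_parent_add_one hne]
  have hF : FR S p f c lam alpha x y η u = ∑ n, (p n *
      ((∑ i, (if n = S.root then f 1 i else (1 - lam (S.stage n)) * f (S.stage n) i)
        * ∑ m ∈ S.path n, x m i)
     + (∑ j, (if n = S.root then c 1 j else (1 - lam (S.stage n)) * c (S.stage n) j) * y n j))
     + ((if n = S.root then 0 else p n * (lam (S.stage n) * η (S.parent n)))
     + p n * ((if n = S.root then 0 else lam (S.stage n) / (1 - alpha (S.stage n))) * u n))) := by
    rw [Finset.sum_add_distrib, Finset.sum_add_distrib, ← hη, ← Finset.sum_add_distrib,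
      ← Finset.sum_add_distrib]
    exact Finset.sum_congr rfl fun n _ => by ring
  rw [hF]
  refine Finset.sum_nonneg fun n _ => ?_
  have h1 := S.stage_ge n
  have h2 := S.stage_le n
  have hX : ∀ i, 0 ≤ ∑ m ∈ S.path n, x m i := fun i => Finset.sum_nonneg fun m _ => hx m i
  refine add_nonneg (mul_nonneg (hp n) (add_nonneg ?_ ?_)) ?_
  · refine Finset.sum_nonneg fun i _ => mul_nonneg ?_ (hX i)
    split_ifs with hn
    · exact hf 1 le_rfl S.hT i
    · exact mul_nonneg (sub_nonneg.mpr (hlam _ (S.two_le_stage hn) h2).2) (hf _ h1 h2 i)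
  · refine Finset.sum_nonneg fun j _ => mul_nonneg ?_ (hy n j)
    split_ifs with hn
    · exact hc 1 le_rfl S.hT j
    · exact mul_nonneg (sub_nonneg.mpr (hlam _ (S.two_le_stage hn) h2).2) (hc _ h1 h2 j)
  · split_ifs with hn
    · simp
    · obtain ⟨hl, -⟩ := hlam _ (S.two_le_stage hn) h2
      obtain ⟨ha0, ha1⟩ := halpha _ (S.two_le_stage hn) h2
      have hdiv : lam (S.stage n) ≤ lam (S.stage n) / (1 - alpha (S.stage n)) :=
        le_div_self hl (by linarith) (by linarith)
      have hsum : 0 ≤ u n + η (S.parent n) :=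
        (add_nonneg (Finset.sum_nonneg fun i _ => mul_nonneg (hf _ h1 h2 i) (hX i))
          (Finset.sum_nonneg fun j _ => mul_nonneg (hc _ h1 h2 j) (hy n j))).trans (hcost n hn)
      rw [← mul_add]
      refine mul_nonneg (hp n) ?_
      nlinarith [mul_nonneg hl hsum, mul_le_mul_of_nonneg_right hdiv (hu n hn)]

end CapacityModel

/-- Theorem 1: lower bound on the value of multistage stochastic
programming.  If `(x*, y*, η*, u*)` is optimal for the two-stage model, then the
gap between its objective value and the multistage optimal value is at least the
stated quantity built from `(y*, u*)`. -/
theorem vms_lower_bound {T M N J : ℕ} (S : STree T)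
    (p : S.Node → ℝ) (f : ℕ → Fin M → ℝ) (c : ℕ → Fin J → ℝ)
    (A : ℕ → Matrix (Fin N) (Fin J) ℝ) (B : ℕ → Matrix (Fin M) (Fin J) ℝ)
    (d : S.Node → Fin N → ℝ) (lam alpha : ℕ → ℝ)
    (hp : ∀ n, 0 ≤ p n)
    (hp1 : ∀ s, 1 ≤ s → s ≤ T → ∑ n ∈ S.stageNodes s, p n = 1)
    (hpc : ∀ n, S.stage n ≠ T → ∑ m ∈ S.children n, p m = p n)
    (hf : ∀ s, 1 ≤ s → s ≤ T → ∀ i, 0 ≤ f s i)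
    (hc : ∀ s, 1 ≤ s → s ≤ T → ∀ j, 0 ≤ c s j)
    (hlam : ∀ s, 2 ≤ s → s ≤ T → 0 ≤ lam s ∧ lam s ≤ 1)
    (halpha : ∀ s, 2 ≤ s → s ≤ T → 0 ≤ alpha s ∧ alpha s < 1)
    (hB : ∀ s, 1 ≤ s → s ≤ T → ∀ i j, 0 ≤ B s i j)
    (xs : S.Node → Fin M → ℤ) (ys : S.Node → Fin J → ℝ) (etas us : S.Node → ℝ)
    (hfeas : MFeasR S f c A B d (fun n i => (xs n i : ℝ)) ys etas us)
    (hts : TSconstr S (fun n i => (xs n i : ℝ)))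
    (hopt : ∀ (x : S.Node → Fin M → ℤ) (y : S.Node → Fin J → ℝ) (η u : S.Node → ℝ),
      MFeasR S f c A B d (fun n i => (x n i : ℝ)) y η u →
      TSconstr S (fun n i => (x n i : ℝ)) →
      FR S p f c lam alpha (fun n i => (xs n i : ℝ)) ys etas us ≤
        FR S p f c lam alpha (fun n i => (x n i : ℝ)) y η u)
    (etaMS etaTS : S.Node → ℝ)
    (xMS xTS : S.Node → Fin M → ℤ)
    (hxMSr : ∀ i, xMS S.root i = ⌈bvec S B ys S.root i⌉)
    (hxMSn : ∀ n, n ≠ S.root → ∀ i,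
      xMS n i = pmc S (bvec S B ys) n i - pmc S (bvec S B ys) (S.parent n) i)
    (hxTSr : ∀ i, xTS S.root i = ⌈stageMax S (bvec S B ys) S.root i⌉)
    (hxTSn : ∀ n, n ≠ S.root → ∀ i,
      xTS n i = pmc S (stageMax S (bvec S B ys)) n i
              - pmc S (stageMax S (bvec S B ys)) (S.parent n) i)
    (hetaMS : ∀ n (hn : S.stage n ≠ T), etaMS n =
      (S.children n).sup' (S.children_nonempty hn) fun m =>
        (∑ i, f (S.stage m) i * ∑ l ∈ S.path m, (xMS l i : ℝ))
          + (∑ j, c (S.stage m) j * ys m j) - us m)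
    (hetaTS : ∀ n (hn : S.stage n ≠ T), etaTS n =
      (S.children n).sup' (S.children_nonempty hn) fun m =>
        (∑ i, f (S.stage m) i * ∑ l ∈ S.path m, (xTS l i : ℝ))
          + (∑ j, c (S.stage m) j * ys m j) - us m) :
    (∑ n ∈ Finset.univ.filter (fun n => n ≠ S.root),
        p n * ((1 - lam (S.stage n)) *
          ∑ i, f (S.stage n) i *
            ((pmc S (stageMax S (bvec S B ys)) n i : ℝ) - (pmc S (bvec S B ys) n i : ℝ))))
      + (∑ n ∈ Finset.univ.filter (fun n => S.stage n ≠ T),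
          p n * lam (S.stage n + 1) * (etaTS n - etaMS n))
      ≤ FR S p f c lam alpha (fun n i => (xs n i : ℝ)) ys etas us
          - zMS S p f c A B d lam alpha := by
  obtain ⟨hx0, hy0, hu0, hA, hcap, hcost⟩ := hfeas
  have hMS := sum_path_eq_pmc S hxMSr hxMSn
  have hTS := sum_path_eq_pmc S hxTSr hxTSn
  have hge := pmc_stageMax_le S (b := bvec S B ys) hx0 hts hcap
  have hbroot : ∀ i, 0 ≤ bvec S B ys S.root i := fun i =>
    dotProduct_nonneg_of_nonneg
      (fun j => hB _ (S.stage_ge S.root) (S.stage_le S.root) i j) (hy0 S.root)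
  have hfeasMS : MFeasR S f c A B d (fun n i => (xMS n i : ℝ)) ys etaMS us := by
    refine ⟨fun n i => ?_, hy0, hu0, hA, fun n i => ?_, fun n hn => ?_⟩
    · exact Int.cast_nonneg (nonneg_of_telescoping S hbroot hxMSr hxMSn n i)
    · rw [hMS]
      exact (Int.le_ceil _).trans (Int.cast_le.mpr (ceil_le_pmc S (bvec S B ys) n i))
    · have hpar : S.stage (S.parent n) ≠ T := by
        have h1 := S.stage_parent_add_one hn
        have h2 := S.stage_le n
        omega
      rw [← sub_le_iff_le_add', hetaMS _ hpar]
      exact Finset.le_sup' (fun m => (∑ i, f (S.stage m) i * ∑ l ∈ S.path m, (xMS l i : ℝ))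
          + (∑ j, c (S.stage m) j * ys m j) - us m)
        (Finset.mem_filter.mpr ⟨Finset.mem_univ n, hn, rfl⟩)
  have hz : zMS S p f c A B d lam alpha ≤
      FR S p f c lam alpha (fun n i => (xMS n i : ℝ)) ys etaMS us := by
    refine csInf_le ⟨0, ?_⟩ ⟨xMS, ys, etaMS, us, hfeasMS, rfl⟩
    rintro v ⟨x, y, η, u, h, rfl⟩
    exact FR_nonneg S hp hpc hf hc hlam halpha h
  have hη : ∀ n, S.stage n ≠ T → etaTS n ≤ etas n := by
    intro n hn
    rw [hetaTS n hn]
    refine Finset.sup'_le _ _ fun m hm => ?_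
    obtain ⟨hne, rfl⟩ := (Finset.mem_filter.mp hm).2
    have h1 := hcost m hne
    have h2 : ∑ i, f (S.stage m) i * ∑ l ∈ S.path m, (xTS l i : ℝ) ≤
        ∑ i, f (S.stage m) i * ∑ l ∈ S.path m, (xs l i : ℝ) :=
      Finset.sum_le_sum fun i _ => mul_le_mul_of_nonneg_left
        ((hTS m i).trans_le (hge m i)) (hf _ (S.stage_ge m) (S.stage_le m) i)
    linarith
  refine le_sub_iff_add_le.mpr ((add_le_add_right hz _).trans ?_)
  rw [Finset.sum_filter, Finset.sum_filter, FR, FR, ← Finset.sum_add_distrib,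
    ← Finset.sum_add_distrib]
  refine Finset.sum_le_sum fun n _ => ?_
  have hcapital : (if n ≠ S.root then (1 - lam (S.stage n)) * ∑ i, f (S.stage n) i *
          ((pmc S (stageMax S (bvec S B ys)) n i : ℝ) - (pmc S (bvec S B ys) n i : ℝ)) else 0)
      + ∑ i, (if n = S.root then f 1 i else (1 - lam (S.stage n)) * f (S.stage n) i)
          * ∑ m ∈ S.path n, (xMS m i : ℝ)
      ≤ ∑ i, (if n = S.root then f 1 i else (1 - lam (S.stage n)) * f (S.stage n) i)
          * ∑ m ∈ S.path n, (xs m i : ℝ) := by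
    by_cases hn : n = S.root
    · subst hn
      simp only [ne_eq, not_true_eq_false, if_false, if_true, zero_add]
      refine Finset.sum_le_sum fun i _ =>
        mul_le_mul_of_nonneg_left ?_ (hf 1 le_rfl S.hT i)
      have h := hge S.root i
      rwa [pmc_root, stageMax_root, ← pmc_root S (bvec S B ys), ← hMS] at h
    · simp only [ne_eq, hn, not_false_eq_true, if_true, if_false]
      rw [Finset.mul_sum, ← Finset.sum_add_distrib]
      refine Finset.sum_le_sum fun i _ => ?_
      have hcoef : 0 ≤ (1 - lam (S.stage n)) * f (S.stage n) i :=
        mul_nonneg (sub_nonneg.mpr (hlam _ (S.two_le_stage hn) (S.stage_le n)).2)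
          (hf _ (S.stage_ge n) (S.stage_le n) i)
      rw [hMS]
      linarith [mul_le_mul_of_nonneg_left (hge n i) hcoef]
  have hrisk : (if S.stage n ≠ T then lam (S.stage n + 1) * (etaTS n - etaMS n) else 0)
      + (if S.stage n = T then 0 else lam (S.stage n + 1)) * etaMS n
      ≤ (if S.stage n = T then 0 else lam (S.stage n + 1)) * etas n := by
    by_cases hn : S.stage n = T
    · simp [hn]
    · simp only [ne_eq, hn, not_false_eq_true, if_true, if_false]
      have h1 := S.stage_ge n
      have h2 := S.stage_le n
      have hl := (hlam (S.stage n + 1) (by omega) (by omega)).1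
      linarith [mul_le_mul_of_nonneg_left (hη n hn) hl]
  rw [mul_assoc (p n), ← mul_ite_zero (n ≠ S.root) (p n), ← mul_ite_zero (S.stage n ≠ T) (p n),
    ← mul_add, ← mul_add]
  exact mul_le_mul_of_nonneg_left (by linarith) (hp n)
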